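/- Suppose g'(u) ≠ 0 for all u, the spherical curvature κ is a constant κ₀ ≠ 0, and f κ_α is a constant a ≠ 0. Then M² does not have pointwise 1-type Gauss map of the second kind: there exist no smooth nowhere-zero function λ on I × J and nonzero constant bivector C ∈ Λ²ℝ⁴ with ΔG = λ(G + C). -/

import Mathlib

open Matrix

noncomputable section

/-- The embedding of `ℝ³ = span{e₁,e₂,e₃}` into `ℝ⁴`. -/
def emb (p : Fin 3 → ℝ) : Fin 4 → ℝ := ![p 0, p 1, p 2, 0]

/-- The fourth standard basis vector `e₄` of `ℝ⁴`. -/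
def e4 : Fin 4 → ℝ := ![0, 0, 0, 1]

/-- Model of the bivector `a ∧ b ∈ Λ²ℝ⁴` as the antisymmetric matrix `aᵢbⱼ − aⱼbᵢ`. -/
def wedge (a b : Fin 4 → ℝ) : Fin 4 → Fin 4 → ℝ := fun i j => a i * b j - a j * b i

/-- The tangent `t = r'` of the spherical curve `r`. -/
def sphT (r : ℝ → Fin 3 → ℝ) : ℝ → Fin 3 → ℝ := deriv r

/-- The normal `n = r × t` of the spherical curve `r`. -/
def sphN (r : ℝ → Fin 3 → ℝ) (v : ℝ) : Fin 3 → ℝ := crossProduct (r v) (deriv r v)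

/-- The spherical curvature `κ = ⟨t', n⟩` of the spherical curve `r`. -/
def sphCurv (r : ℝ → Fin 3 → ℝ) (v : ℝ) : ℝ := deriv (deriv r) v ⬝ᵥ sphN r v

/-- The curvature `κ_α = f′g″ − g′f″` of the meridian curve `α = (f, g)`. -/
def merCurv (f g : ℝ → ℝ) (u : ℝ) : ℝ :=
  deriv f u * deriv (deriv g) u - deriv g u * deriv (deriv f) u

/-- The parametrization `z(u,v) = f(u) r(v) + g(u) e₄` of the meridian surface `M²`. -/
def mz (f g : ℝ → ℝ) (r : ℝ → Fin 3 → ℝ) (u v : ℝ) : Fin 4 → ℝ :=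
  f u • emb (r v) + g u • e4

/-- The tangent frame vector `x = ∂z/∂u = f′ r + g′ e₄`. -/
def mx (f g : ℝ → ℝ) (r : ℝ → Fin 3 → ℝ) (u v : ℝ) : Fin 4 → ℝ :=
  deriv f u • emb (r v) + deriv g u • e4

/-- The tangent frame vector `y = (1/f) ∂z/∂v = t`. -/
def my (r : ℝ → Fin 3 → ℝ) (v : ℝ) : Fin 4 → ℝ := emb (deriv r v)

/-- The normal frame vector `n₁ = n`. -/
def mn1 (r : ℝ → Fin 3 → ℝ) (v : ℝ) : Fin 4 → ℝ := emb (sphN r v)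

/-- The normal frame vector `n₂ = −g′ r + f′ e₄`. -/
def mn2 (f g : ℝ → ℝ) (r : ℝ → Fin 3 → ℝ) (u v : ℝ) : Fin 4 → ℝ :=
  (-(deriv g u)) • emb (r v) + deriv f u • e4

/-- The Gauss map `G = x ∧ y` of the meridian surface, with values in `Λ²ℝ⁴`. -/
def gaussG (f g : ℝ → ℝ) (r : ℝ → Fin 3 → ℝ) (u v : ℝ) : Fin 4 → Fin 4 → ℝ :=
  wedge (mx f g r u v) (my r v)

/-- The Laplacian `Δφ = −(∂²φ/∂u² + (1/f²) ∂²φ/∂v² + (f′/f) ∂φ/∂u)` of the meridian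
surface, acting on `Λ²ℝ⁴`-valued functions. -/
def surfLap (f : ℝ → ℝ) (φ : ℝ → ℝ → Fin 4 → Fin 4 → ℝ) (u v : ℝ) : Fin 4 → Fin 4 → ℝ :=
  -(deriv (deriv (fun s => φ s v)) u + (1 / f u ^ 2) • deriv (deriv (fun s => φ u s)) v
    + (deriv f u / f u) • deriv (fun s => φ s v) u)

/-- `h(x,x)`: the normal component (w.r.t. `{n₁, n₂}`) of `∇′ₓx = ∂x/∂u`. -/
def hxx (f g : ℝ → ℝ) (r : ℝ → Fin 3 → ℝ) (u v : ℝ) : Fin 4 → ℝ :=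
  (deriv (fun s => mx f g r s v) u ⬝ᵥ mn1 r v) • mn1 r v
    + (deriv (fun s => mx f g r s v) u ⬝ᵥ mn2 f g r u v) • mn2 f g r u v

/-- `h(x,y)`: the normal component (w.r.t. `{n₁, n₂}`) of `∇′_y x = (1/f) ∂x/∂v`. -/
def hxy (f g : ℝ → ℝ) (r : ℝ → Fin 3 → ℝ) (u v : ℝ) : Fin 4 → ℝ :=
  (((1 / f u) • deriv (fun s => mx f g r u s) v) ⬝ᵥ mn1 r v) • mn1 r v
    + (((1 / f u) • deriv (fun s => mx f g r u s) v) ⬝ᵥ mn2 f g r u v) • mn2 f g r u v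

/-- `h(y,y)`: the normal component (w.r.t. `{n₁, n₂}`) of `∇′_y y = (1/f) ∂y/∂v`. -/
def hyy (f g : ℝ → ℝ) (r : ℝ → Fin 3 → ℝ) (u v : ℝ) : Fin 4 → ℝ :=
  (((1 / f u) • deriv (my r) v) ⬝ᵥ mn1 r v) • mn1 r v
    + (((1 / f u) • deriv (my r) v) ⬝ᵥ mn2 f g r u v) • mn2 f g r u v


theorem ContDiffOn.infty_deriv {E : Type*} [NormedAddCommGroup E] [NormedSpace ℝ E]
    {s : Set ℝ} {φ : ℝ → E} (hs : IsOpen s) (h : ContDiffOn ℝ (⊤ : ℕ∞) φ s) :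
    ContDiffOn ℝ (⊤ : ℕ∞) (deriv φ) s :=
  h.deriv_of_isOpen hs (by simp)

theorem ContDiffOn.infty_hasDerivAt {E : Type*} [NormedAddCommGroup E] [NormedSpace ℝ E]
    {s : Set ℝ} {φ : ℝ → E} (hs : IsOpen s) (h : ContDiffOn ℝ (⊤ : ℕ∞) φ s) {x : ℝ}
    (hx : x ∈ s) : HasDerivAt φ (deriv φ x) x :=
  ((h.differentiableOn (by simp)).differentiableAt (hs.mem_nhds hx)).hasDerivAt

/-- Two functions agreeing on an open set have equal derivatives there. -/
theorem IsOpen.deriv_eq_of_eqOn {E : Type*} [NormedAddCommGroup E] [NormedSpace ℝ E]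
    {s : Set ℝ} {φ ψ : ℝ → E} (hs : IsOpen s) (h : Set.EqOn φ ψ s) {x : ℝ} (hx : x ∈ s)
    {d e : E} (hφ : HasDerivAt φ d x) (hψ : HasDerivAt ψ e x) : d = e :=
  hφ.unique (hψ.congr_of_eventuallyEq (h.eventuallyEq_of_mem (hs.mem_nhds hx)))

theorem hasDerivAt_emb {p : ℝ → Fin 3 → ℝ} {p' : Fin 3 → ℝ} {v : ℝ} (h : HasDerivAt p p' v) :
    HasDerivAt (fun s => emb (p s)) (emb p') v := by
  rw [hasDerivAt_pi] at h ⊢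
  intro i
  fin_cases i
  · exact h 0
  · exact h 1
  · exact h 2
  · exact hasDerivAt_const v 0

theorem hasDerivAt_wedge {p q : ℝ → Fin 4 → ℝ} {p' q' : Fin 4 → ℝ} {v : ℝ}
    (hp : HasDerivAt p p' v) (hq : HasDerivAt q q' v) :
    HasDerivAt (fun s => wedge (p s) (q s)) (wedge p' (q v) + wedge (p v) q') v := by
  rw [hasDerivAt_pi] at hp hq ⊢
  intro i
  rw [hasDerivAt_pi]
  intro j
  refine (((hp i).mul (hq j)).sub ((hp j).mul (hq i))).congr_deriv ?_
  simp only [wedge, Pi.add_apply]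
  ring

theorem hasDerivAt_dotProduct {p q : ℝ → Fin 3 → ℝ} {p' q' : Fin 3 → ℝ} {v : ℝ}
    (hp : HasDerivAt p p' v) (hq : HasDerivAt q q' v) :
    HasDerivAt (fun s => p s ⬝ᵥ q s) (p' ⬝ᵥ q v + p v ⬝ᵥ q') v := by
  rw [hasDerivAt_pi] at hp hq
  simp only [dotProduct, ← Finset.sum_add_distrib]
  exact HasDerivAt.fun_sum fun i _ => (hp i).mul (hq i)

theorem hasDerivAt_crossProduct {p q : ℝ → Fin 3 → ℝ} {p' q' : Fin 3 → ℝ} {v : ℝ}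
    (hp : HasDerivAt p p' v) (hq : HasDerivAt q q' v) :
    HasDerivAt (fun s => crossProduct (p s) (q s))
      (crossProduct p' (q v) + crossProduct (p v) q') v := by
  rw [hasDerivAt_pi] at hp hq ⊢
  intro i
  fin_cases i
  · refine (((hp 1).mul (hq 2)).sub ((hp 2).mul (hq 1))).congr_deriv ?_
    simp [cross_apply]; ring
  · refine (((hp 2).mul (hq 0)).sub ((hp 0).mul (hq 2))).congr_deriv ?_
    simp [cross_apply]; ring
  · refine (((hp 0).mul (hq 1)).sub ((hp 1).mul (hq 0))).congr_deriv ?_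
    simp [cross_apply]; ring

/-- Expansion of a vector in the positive orthonormal basis `p, q, p × q` of `ℝ³`. -/
theorem eq_sum_orthonormal_cross {p q : Fin 3 → ℝ} (hp : p ⬝ᵥ p = 1) (hq : q ⬝ᵥ q = 1)
    (hpq : p ⬝ᵥ q = 0) (w : Fin 3 → ℝ) :
    w = (w ⬝ᵥ p) • p + (w ⬝ᵥ q) • q + (w ⬝ᵥ crossProduct p q) • crossProduct p q := by
  set n := crossProduct p q with hn
  have h1 : crossProduct q n = p := by
    rw [hn, cross_cross_eq_smul_sub_smul']; simp [hq, hpq]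
  have h2 : crossProduct n p = q := by
    rw [hn, cross_cross_eq_smul_sub_smul]; simp [hp, hpq, dotProduct_comm q p]
  have hA : ∀ z, crossProduct n z = (p ⬝ᵥ z) • q - (q ⬝ᵥ z) • p := fun z =>
    cross_cross_eq_smul_sub_smul p q z
  have hnn : n ⬝ᵥ n = 1 := by
    rw [hn, cross_dot_cross, hp, hq, hpq]; ring
  have key := cross_cross_eq_smul_sub_smul' n n w
  rw [hnn, hA w, map_sub, map_smul, map_smul, h2, ← neg_cross q n, h1] at key
  have : w = (n ⬝ᵥ w) • n - ((p ⬝ᵥ w) • (-p) - (q ⬝ᵥ w) • q) := by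
    rw [key]; simp
  rw [dotProduct_comm w p, dotProduct_comm w q, dotProduct_comm w n]
  conv_lhs => rw [this]
  module

section SphericalCurve

variable {J : Set ℝ} {r : ℝ → Fin 3 → ℝ}

theorem dot_deriv_eq_zero_of_dot_self_eq_one (hJ : IsOpen J) (hr : ContDiffOn ℝ (⊤ : ℕ∞) r J)
    (hrs : ∀ v ∈ J, r v ⬝ᵥ r v = 1) {v : ℝ} (hv : v ∈ J) : r v ⬝ᵥ deriv r v = 0 := by
  have h := hr.infty_hasDerivAt hJ hv
  have := hJ.deriv_eq_of_eqOn hrs hv (hasDerivAt_dotProduct h h) (hasDerivAt_const v 1)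
  rw [dotProduct_comm (deriv r v)] at this
  linarith

/-- The Frenet equation `t' = -r + κ n` of a spherical curve. -/
theorem deriv_deriv_eq_of_spherical (hJ : IsOpen J) (hr : ContDiffOn ℝ (⊤ : ℕ∞) r J)
    (hrs : ∀ v ∈ J, r v ⬝ᵥ r v = 1) (hra : ∀ v ∈ J, deriv r v ⬝ᵥ deriv r v = 1)
    {v : ℝ} (hv : v ∈ J) : deriv (deriv r) v = -r v + sphCurv r v • sphN r v := by
  have hrt := fun w hw => dot_deriv_eq_zero_of_dot_self_eq_one hJ hr hrs (v := w) hw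
  have htt := dot_deriv_eq_zero_of_dot_self_eq_one hJ (hr.infty_deriv hJ) hra hv
  have h := hJ.deriv_eq_of_eqOn hrt hv (hasDerivAt_dotProduct (hr.infty_hasDerivAt hJ hv)
    ((hr.infty_deriv hJ).infty_hasDerivAt hJ hv)) (hasDerivAt_const v 0)
  rw [hra v hv] at h
  have hw := eq_sum_orthonormal_cross (hrs v hv) (hra v hv) (hrt v hv) (deriv (deriv r) v)
  rw [dotProduct_comm _ (r v), dotProduct_comm _ (deriv r v), htt,
    show r v ⬝ᵥ deriv (deriv r) v = -1 by linarith] at hw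
  rw [sphCurv, sphN]
  refine hw.trans ?_
  module

/-- The Frenet equation `n' = -κ t` of a spherical curve. -/
theorem hasDerivAt_sphN (hJ : IsOpen J) (hr : ContDiffOn ℝ (⊤ : ℕ∞) r J)
    (hrs : ∀ v ∈ J, r v ⬝ᵥ r v = 1) (hra : ∀ v ∈ J, deriv r v ⬝ᵥ deriv r v = 1)
    {v : ℝ} (hv : v ∈ J) : HasDerivAt (sphN r) (-sphCurv r v • deriv r v) v := by
  refine (hasDerivAt_crossProduct (hr.infty_hasDerivAt hJ hv)
    ((hr.infty_deriv hJ).infty_hasDerivAt hJ hv)).congr_deriv ?_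
  rw [deriv_deriv_eq_of_spherical hJ hr hrs hra hv, cross_self, map_add, map_neg, map_smul,
    cross_self, sphN, cross_cross_eq_smul_sub_smul', hrs v hv,
    dot_deriv_eq_zero_of_dot_self_eq_one hJ hr hrs hv]
  module

theorem deriv_deriv_deriv_eq_of_spherical (hJ : IsOpen J) (hr : ContDiffOn ℝ (⊤ : ℕ∞) r J)
    (hrs : ∀ v ∈ J, r v ⬝ᵥ r v = 1) (hra : ∀ v ∈ J, deriv r v ⬝ᵥ deriv r v = 1)
    {κ₀ : ℝ} (hκ : ∀ v ∈ J, sphCurv r v = κ₀) {v : ℝ} (hv : v ∈ J) :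
    deriv (deriv (deriv r)) v = -(1 + κ₀ ^ 2) • deriv r v := by
  have hE : Set.EqOn (deriv (deriv r)) (fun w => -r w + κ₀ • sphN r w) J := fun w hw => by
    rw [deriv_deriv_eq_of_spherical hJ hr hrs hra hw, hκ w hw]
  have hN := hasDerivAt_sphN hJ hr hrs hra hv
  rw [hJ.deriv_eq_of_eqOn hE hv (((hr.infty_deriv hJ).infty_deriv hJ).infty_hasDerivAt hJ hv)
    ((hr.infty_hasDerivAt hJ hv).neg.add (hN.const_smul κ₀)), hκ v hv]
  module

end SphericalCurve

section Meridian

variable {I : Set ℝ} {f g : ℝ → ℝ}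

/-- The Frenet equation `(f″, g″) = κ_α (-g′, f′)` of a plane curve parametrized by arc length. -/
theorem deriv_deriv_eq_of_arclength (hI : IsOpen I) (hf : ContDiffOn ℝ (⊤ : ℕ∞) f I)
    (hg : ContDiffOn ℝ (⊤ : ℕ∞) g I) (hfg : ∀ u ∈ I, deriv f u ^ 2 + deriv g u ^ 2 = 1)
    {u : ℝ} (hu : u ∈ I) :
    deriv (deriv f) u = -(merCurv f g u * deriv g u) ∧
      deriv (deriv g) u = merCurv f g u * deriv f u := by
  have h := hI.deriv_eq_of_eqOn hfg hu
    ((((hf.infty_deriv hI).infty_hasDerivAt hI hu).fun_pow 2).add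
      (((hg.infty_deriv hI).infty_hasDerivAt hI hu).fun_pow 2)) (hasDerivAt_const u 1)
  have h1 := hfg u hu
  simp only [Nat.cast_ofNat, Nat.add_one_sub_one, pow_one] at h
  have h2 : deriv f u * deriv (deriv f) u + deriv g u * deriv (deriv g) u = 0 := by linarith
  unfold merCurv
  constructor
  · linear_combination (-deriv (deriv f) u) * h1 + deriv f u * h2
  · linear_combination (-deriv (deriv g) u) * h1 + deriv g u * h2

theorem deriv_deriv_deriv_eq_of_arclength (hI : IsOpen I) (hf : ContDiffOn ℝ (⊤ : ℕ∞) f I)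
    (hg : ContDiffOn ℝ (⊤ : ℕ∞) g I) (hf0 : ∀ u ∈ I, f u ≠ 0)
    (hfg : ∀ u ∈ I, deriv f u ^ 2 + deriv g u ^ 2 = 1)
    {a : ℝ} (ha : ∀ u ∈ I, f u * merCurv f g u = a) {u : ℝ} (hu : u ∈ I) :
    deriv (deriv (deriv f)) u + deriv f u / f u * deriv (deriv f) u
        = -(a ^ 2 * deriv f u / f u ^ 2) ∧
      deriv (deriv (deriv g)) u + deriv f u / f u * deriv (deriv g) u
        = -(a ^ 2 * deriv g u / f u ^ 2) := by
  have hk : ∀ w ∈ I, merCurv f g w = a / f w := fun w hw => by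
    rw [eq_div_iff (hf0 w hw), mul_comm, ha w hw]
  have hF : Set.EqOn (deriv (deriv f)) (fun w => -(a * deriv g w) / f w) I := fun w hw => by
    beta_reduce
    rw [(deriv_deriv_eq_of_arclength hI hf hg hfg hw).1, hk w hw]; ring
  have hG : Set.EqOn (deriv (deriv g)) (fun w => a * deriv f w / f w) I := fun w hw => by
    beta_reduce
    rw [(deriv_deriv_eq_of_arclength hI hf hg hfg hw).2, hk w hw]; ring
  have df := hf.infty_hasDerivAt hI hu
  have d2f := (hf.infty_deriv hI).infty_hasDerivAt hI hu
  have d2g := (hg.infty_deriv hI).infty_hasDerivAt hI hu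
  have h0 := hf0 u hu
  rw [hI.deriv_eq_of_eqOn hF hu (((hf.infty_deriv hI).infty_deriv hI).infty_hasDerivAt hI hu)
      ((d2g.const_mul a).fun_neg.fun_div df h0),
    hI.deriv_eq_of_eqOn hG hu (((hg.infty_deriv hI).infty_deriv hI).infty_hasDerivAt hI hu)
      ((d2f.const_mul a).fun_div df h0), hF hu, hG hu]
  constructor <;> · field_simp; ring

end Meridian

theorem gaussG_eq (f g : ℝ → ℝ) (r : ℝ → Fin 3 → ℝ) (u v : ℝ) :
    gaussG f g r u v = deriv f u • wedge (emb (r v)) (emb (deriv r v))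
      + deriv g u • wedge e4 (emb (deriv r v)) := by
  ext i j
  simp only [gaussG, mx, my, wedge, Pi.add_apply, Pi.smul_apply, smul_eq_mul]
  ring

theorem wedge_self (p : Fin 4 → ℝ) : wedge p p = 0 := by
  ext i j
  simp only [wedge, Pi.zero_apply]
  ring

theorem surfLap_gaussG {I J : Set ℝ} {r : ℝ → Fin 3 → ℝ} {f g : ℝ → ℝ} (hI : IsOpen I)
    (hJ : IsOpen J) (hr : ContDiffOn ℝ (⊤ : ℕ∞) r J) (hf : ContDiffOn ℝ (⊤ : ℕ∞) f I)
    (hg : ContDiffOn ℝ (⊤ : ℕ∞) g I) {u v : ℝ} (hu : u ∈ I) (hv : v ∈ J) :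
    surfLap f (gaussG f g r) u v =
      -(deriv (deriv (deriv f)) u + deriv f u / f u * deriv (deriv f) u) •
          wedge (emb (r v)) (emb (deriv r v))
        - (deriv (deriv (deriv g)) u + deriv f u / f u * deriv (deriv g) u) •
          wedge e4 (emb (deriv r v))
        - (1 / f u ^ 2) • (deriv f u • (wedge (emb (deriv r v)) (emb (deriv (deriv r) v))
            + wedge (emb (r v)) (emb (deriv (deriv (deriv r)) v)))
          + deriv g u • wedge e4 (emb (deriv (deriv (deriv r)) v))) := by
  have hf1 := hf.infty_deriv hI
  have hf2 := hf1.infty_deriv hI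
  have hg1 := hg.infty_deriv hI
  have hg2 := hg1.infty_deriv hI
  have hr1 := hr.infty_deriv hJ
  have hr2 := hr1.infty_deriv hJ
  have hU : Set.EqOn (deriv fun s => gaussG f g r s v)
      (fun s => deriv (deriv f) s • wedge (emb (r v)) (emb (deriv r v))
        + deriv (deriv g) s • wedge e4 (emb (deriv r v))) I := fun s hs => by
    simp only [gaussG_eq]
    exact (((hf1.infty_hasDerivAt hI hs).smul_const _).fun_add
      ((hg1.infty_hasDerivAt hI hs).smul_const _)).deriv
  have hU2 := (((hf2.infty_hasDerivAt hI hu).smul_const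
    (wedge (emb (r v)) (emb (deriv r v)))).fun_add
    ((hg2.infty_hasDerivAt hI hu).smul_const (wedge e4 (emb (deriv r v)))))
  have hV : Set.EqOn (deriv fun s => gaussG f g r u s)
      (fun s => deriv f u • wedge (emb (r s)) (emb (deriv (deriv r) s))
        + deriv g u • wedge e4 (emb (deriv (deriv r) s))) J := fun s hs => by
    simp only [gaussG_eq]
    have d0 := hasDerivAt_emb (hr.infty_hasDerivAt hJ hs)
    have d1 := hasDerivAt_emb (hr1.infty_hasDerivAt hJ hs)
    refine ((((hasDerivAt_wedge d0 d1).const_smul (deriv f u)).fun_add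
      ((hasDerivAt_wedge (hasDerivAt_const s e4) d1).const_smul (deriv g u))).congr_deriv ?_).deriv
    rw [wedge_self]
    ext i j
    simp [wedge]
  have d0 := hasDerivAt_emb (hr.infty_hasDerivAt hJ hv)
  have d2 := hasDerivAt_emb (hr2.infty_hasDerivAt hJ hv)
  have hV2 := ((hasDerivAt_wedge d0 d2).const_smul (deriv f u)).fun_add
      ((hasDerivAt_wedge (hasDerivAt_const v e4) d2).const_smul (deriv g u))
  rw [surfLap, hU hu,
    (hU2.congr_of_eventuallyEq (hU.eventuallyEq_of_mem (hI.mem_nhds hu))).deriv,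
    (hV2.congr_of_eventuallyEq (hV.eventuallyEq_of_mem (hJ.mem_nhds hv))).deriv]
  ext i j
  simp only [wedge, Pi.add_apply, Pi.sub_apply, Pi.neg_apply, Pi.smul_apply, smul_eq_mul,
    Pi.zero_apply]
  ring

theorem emb_add_smul (p q : Fin 3 → ℝ) (c d : ℝ) :
    emb (c • p + d • q) = c • emb p + d • emb q := by
  ext i
  fin_cases i <;> simp [emb]

theorem emb_smul (p : Fin 3 → ℝ) (c : ℝ) : emb (c • p) = c • emb p := by
  ext i
  fin_cases i <;> simp [emb]

/-- The Laplacian of the Gauss map when `κ` and `f κ_α` are constant. -/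
theorem surfLap_gaussG_of_const {I J : Set ℝ} {r : ℝ → Fin 3 → ℝ} {f g : ℝ → ℝ} (hI : IsOpen I)
    (hJ : IsOpen J) (hr : ContDiffOn ℝ (⊤ : ℕ∞) r J)
    (hrs : ∀ v ∈ J, r v ⬝ᵥ r v = 1) (hra : ∀ v ∈ J, deriv r v ⬝ᵥ deriv r v = 1)
    (hf : ContDiffOn ℝ (⊤ : ℕ∞) f I) (hg : ContDiffOn ℝ (⊤ : ℕ∞) g I)
    (hf0 : ∀ u ∈ I, f u ≠ 0) (hfg : ∀ u ∈ I, deriv f u ^ 2 + deriv g u ^ 2 = 1)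
    {κ₀ a : ℝ} (hκ : ∀ v ∈ J, sphCurv r v = κ₀) (ha : ∀ u ∈ I, f u * merCurv f g u = a)
    {u v : ℝ} (hu : u ∈ I) (hv : v ∈ J) :
    surfLap f (gaussG f g r) u v =
      ((a ^ 2 + κ₀ ^ 2) * deriv f u / f u ^ 2) • wedge (emb (r v)) (emb (deriv r v))
        + ((a ^ 2 + κ₀ ^ 2 + 1) * deriv g u / f u ^ 2) • wedge e4 (emb (deriv r v))
        - (κ₀ * deriv f u / f u ^ 2) • wedge (emb (deriv r v)) (emb (sphN r v)) := by
  obtain ⟨h1, h2⟩ := deriv_deriv_deriv_eq_of_arclength hI hf hg hf0 hfg ha hu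
  have e : -r v + κ₀ • sphN r v = (-1 : ℝ) • r v + κ₀ • sphN r v := by module
  rw [surfLap_gaussG hI hJ hr hf hg hu hv, h1, h2,
    deriv_deriv_deriv_eq_of_spherical hJ hr hrs hra hκ hv,
    deriv_deriv_eq_of_spherical hJ hr hrs hra hv, hκ v hv, e, emb_add_smul, emb_smul]
  ext i j
  simp only [wedge, Pi.add_apply, Pi.sub_apply, Pi.smul_apply, smul_eq_mul]
  ring

/-- For `g′ ≠ 0` everywhere, `κ ≡ κ₀ ≠ 0` and `fκ_α ≡ a ≠ 0`: the
meridian surface does not have pointwise 1-type Gauss map of the second kind — there are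
no smooth nowhere-zero `λ` and nonzero constant bivector `C` with `ΔG = λ(G + C)`. -/
theorem meridian_surface_no_second_kind_of_constant_curvatures
    (I J : Set ℝ) (hI : IsOpen I) (hIiv : I.OrdConnected) (hIne : I.Nonempty)
    (hJ : IsOpen J) (hJiv : J.OrdConnected) (hJne : J.Nonempty)
    (r : ℝ → Fin 3 → ℝ) (hr : ContDiffOn ℝ (⊤ : ℕ∞) r J)
    (hrs : ∀ v ∈ J, r v ⬝ᵥ r v = 1) (hra : ∀ v ∈ J, deriv r v ⬝ᵥ deriv r v = 1)
    (f g : ℝ → ℝ) (hf : ContDiffOn ℝ (⊤ : ℕ∞) f I) (hg : ContDiffOn ℝ (⊤ : ℕ∞) g I)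
    (hf0 : ∀ u ∈ I, f u ≠ 0) (hfg : ∀ u ∈ I, deriv f u ^ 2 + deriv g u ^ 2 = 1)
    (hg' : ∀ u ∈ I, deriv g u ≠ 0)
    (κ₀ : ℝ) (hκ0 : κ₀ ≠ 0) (hκ : ∀ v ∈ J, sphCurv r v = κ₀)
    (a : ℝ) (ha0 : a ≠ 0) (ha : ∀ u ∈ I, f u * merCurv f g u = a) :
    ¬ ∃ (lam : ℝ → ℝ → ℝ) (C : Fin 4 → Fin 4 → ℝ),
        ContDiffOn ℝ (⊤ : ℕ∞) (Function.uncurry lam) (I ×ˢ J) ∧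
        (∀ u ∈ I, ∀ v ∈ J, lam u v ≠ 0) ∧
        (∀ i j, C i j = -C j i) ∧ C ≠ 0 ∧
        ∀ u ∈ I, ∀ v ∈ J, surfLap f (gaussG f g r) u v = lam u v • (gaussG f g r u v + C) := by
  rintro ⟨lam, C, -, hlam, -, -, hE⟩
  obtain ⟨u₀, hu₀⟩ := hIne
  obtain ⟨v₀, hv₀⟩ := hJne
  have hL : ∀ u ∈ I, ∀ v ∈ J, _ := fun u hu v hv =>
    (surfLap_gaussG_of_const hI hJ hr hrs hra hf hg hf0 hfg hκ ha hu hv).symm.trans (hE u hu v hv)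
  simp only [gaussG_eq] at hL
  have hm : 0 < a ^ 2 + κ₀ ^ 2 + 1 := by positivity
  set m := a ^ 2 + κ₀ ^ 2 + 1
  let c : Fin 3 → ℝ := ![C 3 0, C 3 1, C 3 2]
  have hc : ∀ u ∈ I, ∀ v ∈ J,
      lam u v • c = (m * deriv g u / f u ^ 2 - lam u v * deriv g u) • deriv r v := by
    intro u hu v hv
    have key : ∀ j, _ := fun j => congrFun (congrFun (hL u hu v hv) 3) j
    have k0 := key 0
    have k1 := key 1
    have k2 := key 2
    simp [wedge, emb, e4] at k0 k1 k2
    ext j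
    fin_cases j
    · simp [c]; linarith
    · simp [c]; linarith
    · simp [c]; linarith
  have hcn : ∀ v ∈ J, c ⬝ᵥ sphN r v = 0 := by
    intro v hv
    have h := congrArg (· ⬝ᵥ sphN r v) (hc u₀ hu₀ v hv)
    simpa [sphN, dot_cross_self, hlam u₀ hu₀ v hv] using h
  have hct : c ⬝ᵥ deriv r v₀ = 0 := by
    have h := hJ.deriv_eq_of_eqOn hcn hv₀ (hasDerivAt_dotProduct (hasDerivAt_const v₀ c)
      (hasDerivAt_sphN hJ hr hrs hra hv₀)) (hasDerivAt_const v₀ 0)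
    simpa [hκ v₀ hv₀, hκ0] using h
  have hlam_eq : ∀ u ∈ I, lam u v₀ = m / f u ^ 2 := by
    intro u hu
    have h := congrArg (· ⬝ᵥ deriv r v₀) (hc u hu v₀ hv₀)
    simp only [smul_dotProduct, hct, hra v₀ hv₀, smul_eq_mul, mul_zero, mul_one] at h
    have : deriv g u * (m / f u ^ 2 - lam u v₀) = 0 := by rw [h]; ring
    have := (mul_eq_zero.mp this).resolve_left (hg' u hu)
    linarith
  let D : Fin 3 → ℝ := ![C 1 2, C 2 0, C 0 1]
  have hD : ∀ u ∈ I, lam u v₀ • (deriv f u • sphN r v₀ + D) =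
      ((a ^ 2 + κ₀ ^ 2) * deriv f u / f u ^ 2) • sphN r v₀
        - (κ₀ * deriv f u / f u ^ 2) • crossProduct (deriv r v₀) (sphN r v₀) := by
    intro u hu
    have key : ∀ i j, _ := fun i j => congrFun (congrFun (hL u hu v₀ hv₀) i) j
    have k0 := key 1 2
    have k1 := key 2 0
    have k2 := key 0 1
    simp only [wedge, emb, e4, Pi.add_apply, Pi.sub_apply, Pi.smul_apply, smul_eq_mul,
      Matrix.cons_val] at k0 k1 k2
    ext j
    fin_cases j
    · simp [D, cross_apply, sphN] at k0 ⊢; linarith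
    · simp [D, cross_apply, sphN] at k1 ⊢; linarith
    · simp [D, cross_apply, sphN] at k2 ⊢; linarith
  have hf' : Set.EqOn (deriv f) (fun _ => -(m * (D ⬝ᵥ r v₀)) / κ₀) I := by
    intro u hu
    have hnr : sphN r v₀ ⬝ᵥ r v₀ = 0 := by
      rw [dotProduct_comm, sphN, dot_self_cross]
    have htn : crossProduct (deriv r v₀) (sphN r v₀) = r v₀ := by
      rw [sphN, cross_cross_eq_smul_sub_smul', hra v₀ hv₀,
        dot_deriv_eq_zero_of_dot_self_eq_one hJ hr hrs hv₀]
      simp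
    have h := congrArg (· ⬝ᵥ r v₀) (hD u hu)
    simp only [htn, smul_dotProduct, add_dotProduct, sub_dotProduct, hnr, hrs v₀ hv₀,
      hlam_eq u hu, smul_eq_mul] at h
    have h0 := hf0 u hu
    field_simp at h ⊢
    linarith
  have hf'' := hI.deriv_eq_of_eqOn hf' hu₀ ((hf.infty_deriv hI).infty_hasDerivAt hI hu₀)
    (hasDerivAt_const u₀ _)
  rw [(deriv_deriv_eq_of_arclength hI hf hg hfg hu₀).1, neg_eq_zero, mul_eq_zero] at hf''
  have hk := hf''.resolve_right (hg' u₀ hu₀)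
  apply ha0
  rw [← ha u₀ hu₀, hk, mul_zero]
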